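/- arXiv:2605.25157 — 2 statements merged into one kernel-verified Lean document; each statement's English description precedes it below -/
import Mathlib

section
/- Let û : ℝ^N → ℝ be the standard Aubin–Talenti profile û(x) = (1 + |x|²)^{−(N−2)/2}. If either N ≥ 4 and s ∈ (0,1), or N = 3 and s ∈ (1/2, 1), then the Gagliardo seminorm of û is finite, i.e. ∫_{ℝ^N} ∫_{ℝ^N} |û(x) − û(y)|² / |x − y|^{N+2s} dx dy < ∞. -/
open Real MeasureTheory ENNReal

/-- The Aubin–Talenti profile `û(x) = (1 + |x|²)^(-(N-2)/2)`. -/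
noncomputable def talentiProfile (N : ℕ) (x : EuclideanSpace ℝ (Fin N)) : ℝ :=
  (1 + ‖x‖ ^ 2) ^ (-(((N : ℝ) - 2) / 2))

section RadialKernel

variable {E : Type*} [NormedAddCommGroup E] [NormedSpace ℝ E] [FiniteDimensional ℝ E]
  [MeasurableSpace E] [BorelSpace E] (μ : Measure E) [μ.IsAddHaarMeasure]

theorem lintegral_comp_inv_smul_addHaar {f : E → ℝ≥0∞} (hf : Measurable f) {c : ℝ} (hc : 0 < c) :
    ∫⁻ x, f (c⁻¹ • x) ∂μ = ENNReal.ofReal (c ^ Module.finrank ℝ E) * ∫⁻ x, f x ∂μ := by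
  rw [← lintegral_map hf (measurable_const_smul c⁻¹),
    Measure.map_addHaar_smul μ (inv_ne_zero hc.ne'), lintegral_smul_measure, inv_pow, inv_inv,
    abs_of_pos (pow_pos hc _), smul_eq_mul]

theorem lintegral_norm_sub_div_addHaar {f : ℝ → ℝ≥0∞} (hf : Measurable f) {c : ℝ} (hc : 0 < c)
    (x : E) :
    ∫⁻ y, f (‖x - y‖ / c) ∂μ
      = ENNReal.ofReal (c ^ Module.finrank ℝ E) * ∫⁻ y, f ‖y‖ ∂μ := by
  rw [lintegral_sub_left_eq_self (fun y => f (‖y‖ / c)) x,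
    ← lintegral_comp_inv_smul_addHaar μ (f := fun y => f ‖y‖) (hf.comp measurable_norm) hc]
  simp [norm_smul, abs_of_pos hc, div_eq_inv_mul]

theorem integrable_min_one_norm_sq_div_rpow [Nontrivial E] {s : ℝ} (hs0 : 0 < s) (hs1 : s < 1) :
    Integrable (fun x : E => min 1 (‖x‖ ^ 2) / ‖x‖ ^ ((Module.finrank ℝ E : ℝ) + 2 * s)) μ := by
  have hd : 1 ≤ Module.finrank ℝ E := Module.finrank_pos
  rw [integrable_fun_norm_addHaar μ
    (f := fun r : ℝ => min 1 (r ^ 2) / r ^ ((Module.finrank ℝ E : ℝ) + 2 * s)),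
    ← Set.Ioc_union_Ioi_eq_Ioi (zero_le_one (α := ℝ))]
  refine IntegrableOn.union ?_ ?_
  · have h : IntegrableOn (fun r : ℝ => r ^ (1 - 2 * s)) (Set.Ioc 0 1) :=
      (intervalIntegrable_iff_integrableOn_Ioc_of_le zero_le_one).1
        (intervalIntegral.intervalIntegrable_rpow' (by linarith))
    refine h.congr_fun (fun r hr => ?_) measurableSet_Ioc
    have hr2 : min 1 (r ^ 2) = r ^ 2 := min_eq_right (pow_le_one₀ hr.1.le hr.2)
    simp only [smul_eq_mul, hr2]
    rw [← Real.rpow_natCast, ← Real.rpow_natCast, ← Real.rpow_sub hr.1, ← Real.rpow_add hr.1]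
    push_cast [hd]
    congr 1
    ring
  · have h : IntegrableOn (fun r : ℝ => r ^ (-1 - 2 * s)) (Set.Ioi 1) :=
      integrableOn_Ioi_rpow_of_lt (by linarith) one_pos
    refine h.congr_fun (fun r hr => ?_) measurableSet_Ioi
    have hr1 : 1 < r := hr
    have hr0 : 0 < r := by linarith
    have hr2 : min 1 (r ^ 2) = 1 := min_eq_left (one_le_pow₀ hr1.le)
    simp only [smul_eq_mul, hr2]
    rw [one_div, ← Real.rpow_natCast, ← Real.rpow_neg hr0.le, ← Real.rpow_add hr0]
    push_cast [hd]
    congr 1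
    ring

end RadialKernel

theorem sqrt_one_add_norm_sq_le_add {E : Type*} [SeminormedAddCommGroup E] (x y : E) :
    √(1 + ‖y‖ ^ 2) ≤ √(1 + ‖x‖ ^ 2) + ‖x - y‖ := by
  have hx : ‖x‖ ≤ √(1 + ‖x‖ ^ 2) := le_sqrt_of_sq_le (by linarith)
  have hy : ‖y‖ ≤ ‖x‖ + ‖x - y‖ := norm_le_norm_add_norm_sub' y x |>.trans_eq (by
    rw [norm_sub_rev])
  have h0 := norm_nonneg (x - y)
  rw [sqrt_le_left (by positivity), add_sq, sq_sqrt (by positivity)]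
  nlinarith [norm_nonneg y, norm_nonneg x, mul_le_mul_of_nonneg_right hx h0]

theorem abs_inv_pow_sub_inv_pow_sq_le {a b r : ℝ} (m : ℕ) (ha : 0 < a) (hab : a ≤ b)
    (hr : b ≤ a + r) :
    |(a ^ m)⁻¹ - (b ^ m)⁻¹| ^ 2 ≤ (m + 1) ^ 2 * (a ^ (2 * m))⁻¹ * min 1 ((r / a) ^ 2) := by
  have hb : 0 < b := ha.trans_le hab
  have ht1 : a / b ≤ 1 := (div_le_one hb).2 hab
  have ht0 : 0 < a / b := div_pos ha hb
  have hp1 : (a / b) ^ m ≤ 1 := pow_le_one₀ ht0.le ht1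
  have hfac : (a ^ m)⁻¹ - (b ^ m)⁻¹ = (a ^ m)⁻¹ * (1 - (a / b) ^ m) := by
    rw [div_pow]; field_simp
  have hbern := one_add_mul_sub_le_pow (show -1 ≤ a / b by linarith) m
  have hm : (0 : ℝ) ≤ m := m.cast_nonneg
  have hr0 : 0 ≤ r := by linarith
  have h1t : 1 - a / b ≤ r / a := by
    calc 1 - a / b = (b - a) / b := by field_simp
      _ ≤ r / a := by gcongr; linarith
  have hle : 1 - (a / b) ^ m ≤ (m + 1) * (r / a) := by
    have : 0 ≤ r / a := by positivity
    nlinarith [mul_le_mul_of_nonneg_left h1t hm]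
  have hsq : (1 - (a / b) ^ m) ^ 2 ≤ (m + 1) ^ 2 * min 1 ((r / a) ^ 2) := by
    rw [mul_min_of_nonneg _ _ (by positivity), ← mul_pow]
    refine le_min ?_ (pow_le_pow_left₀ (by linarith) hle 2)
    rw [mul_one]
    exact pow_le_pow_left₀ (by linarith) (by linarith [pow_nonneg ht0.le m]) 2
  rw [sq_abs, hfac, mul_pow]
  calc _ ≤ ((a ^ m)⁻¹) ^ 2 * ((m + 1) ^ 2 * min 1 ((r / a) ^ 2)) := by gcongr
    _ = _ := by rw [inv_pow, ← pow_mul, mul_comm m 2]; ring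

theorem talentiProfile_eq_inv_pow {N : ℕ} (hN : 2 ≤ N) (x : EuclideanSpace ℝ (Fin N)) :
    talentiProfile N x = (√(1 + ‖x‖ ^ 2) ^ (N - 2))⁻¹ := by
  rw [talentiProfile, Real.rpow_neg (by positivity), Real.rpow_div_two_eq_sqrt _ (by positivity),
    ← Real.rpow_natCast _ (N - 2), Nat.cast_sub hN, Nat.cast_ofNat]

/-- A majorant of the Gagliardo quotient of `talentiProfile N` at the pairs `(x, y)` with
`‖x‖ ≤ ‖y‖`. -/
noncomputable def talentiMajorant (N : ℕ) (s : ℝ) (x y : EuclideanSpace ℝ (Fin N)) : ℝ :=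
  N ^ 2 * √(1 + ‖x‖ ^ 2) ^ (-(2 * (N - 2) + N + 2 * s)) *
    (min 1 ((‖x - y‖ / √(1 + ‖x‖ ^ 2)) ^ 2) / (‖x - y‖ / √(1 + ‖x‖ ^ 2)) ^ ((N : ℝ) + 2 * s))

theorem talentiMajorant_nonneg (N : ℕ) (s : ℝ) (x y : EuclideanSpace ℝ (Fin N)) :
    0 ≤ talentiMajorant N s x y := by
  unfold talentiMajorant
  positivity

theorem talentiMajorant_measurable (N : ℕ) (s : ℝ) :
    Measurable (Function.uncurry (talentiMajorant N s)) := by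
  unfold talentiMajorant Function.uncurry
  fun_prop

theorem gagliardo_quotient_talenti_le {N : ℕ} (hN : 2 ≤ N) (s : ℝ)
    {x y : EuclideanSpace ℝ (Fin N)} (hxy : ‖x‖ ≤ ‖y‖) :
    |talentiProfile N x - talentiProfile N y| ^ 2 / ‖x - y‖ ^ ((N : ℝ) + 2 * s)
      ≤ talentiMajorant N s x y := by
  have hJ : 0 < √(1 + ‖x‖ ^ 2) := sqrt_pos.2 (by positivity)
  have hmono : √(1 + ‖x‖ ^ 2) ≤ √(1 + ‖y‖ ^ 2) := by gcongr
  have key := abs_inv_pow_sub_inv_pow_sq_le (N - 2) hJ hmono (sqrt_one_add_norm_sq_le_add x y)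
  rw [talentiProfile_eq_inv_pow hN, talentiProfile_eq_inv_pow hN]
  unfold talentiMajorant
  set J := √(1 + ‖x‖ ^ 2)
  set r := ‖x - y‖
  have hr : 0 ≤ r := norm_nonneg _
  have hm : ((N - 2 : ℕ) : ℝ) + 1 ≤ N := by
    rw [Nat.cast_sub hN]; push_cast; linarith
  have hpow : J ^ (-(2 * ((N : ℝ) - 2) + N + 2 * s))
      = (J ^ (2 * (N - 2)))⁻¹ * (J ^ ((N : ℝ) + 2 * s))⁻¹ := by
    rw [← Real.rpow_natCast, ← Real.rpow_neg hJ.le, ← Real.rpow_neg hJ.le, ← Real.rpow_add hJ]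
    push_cast [hN]
    congr 1
    ring
  calc _ ≤ ((N : ℝ) ^ 2 * (J ^ (2 * (N - 2)))⁻¹ * min 1 ((r / J) ^ 2)) / r ^ ((N : ℝ) + 2 * s) := by
        refine div_le_div_of_nonneg_right (key.trans ?_) (by positivity)
        gcongr
    _ = _ := by
        have hJp : J ^ ((N : ℝ) + 2 * s) ≠ 0 := (rpow_pos_of_pos hJ _).ne'
        rw [hpow, Real.div_rpow hr hJ.le, div_div_eq_mul_div]
        field_simp

theorem lintegral_talentiMajorant_lt_top {N : ℕ} {s : ℝ} (hN : 1 ≤ N) (hs0 : 0 < s) (hs1 : s < 1)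
    (hNs : 4 < N + 2 * s) :
    ∫⁻ x : EuclideanSpace ℝ (Fin N), ∫⁻ y : EuclideanSpace ℝ (Fin N),
      ENNReal.ofReal (talentiMajorant N s x y) < ∞ := by
  have : Nonempty (Fin N) := ⟨⟨0, hN⟩⟩
  set K := ∫⁻ y : EuclideanSpace ℝ (Fin N),
    ENNReal.ofReal (min 1 (‖y‖ ^ 2) / ‖y‖ ^ ((N : ℝ) + 2 * s))
  have hKtop : K < ∞ := by
    have h := integrable_min_one_norm_sq_div_rpow
      (volume : Measure (EuclideanSpace ℝ (Fin N))) hs0 hs1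
    rw [finrank_euclideanSpace_fin] at h
    exact h.lintegral_lt_top
  have hinner (x : EuclideanSpace ℝ (Fin N)) :
      ∫⁻ y : EuclideanSpace ℝ (Fin N), ENNReal.ofReal (talentiMajorant N s x y)
        = ENNReal.ofReal (N ^ 2 * (1 + ‖x‖ ^ 2) ^ (-(2 * ((N : ℝ) - 2) + 2 * s) / 2)) * K := by
    have hJ : 0 < √(1 + ‖x‖ ^ 2) := sqrt_pos.2 (by positivity)
    have hsub := lintegral_norm_sub_div_addHaar
      (volume : Measure (EuclideanSpace ℝ (Fin N)))
      (f := fun r => ENNReal.ofReal (min 1 (r ^ 2) / r ^ ((N : ℝ) + 2 * s))) (by fun_prop) hJ x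
    rw [finrank_euclideanSpace_fin] at hsub
    simp only [talentiMajorant]
    simp_rw [ENNReal.ofReal_mul (show 0 ≤ (N : ℝ) ^ 2 * √(1 + ‖x‖ ^ 2) ^
      (-(2 * ((N : ℝ) - 2) + N + 2 * s)) by positivity)]
    rw [lintegral_const_mul' _ _ ENNReal.ofReal_ne_top, hsub, ← mul_assoc,
      ← ENNReal.ofReal_mul (by positivity), mul_assoc, ← Real.rpow_natCast _ N, ← Real.rpow_add hJ,
      Real.rpow_div_two_eq_sqrt _ (by positivity)]
    congr 4
    ring
  simp_rw [hinner]
  rw [lintegral_mul_const' _ _ hKtop.ne]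
  refine ENNReal.mul_lt_top ?_ hKtop
  exact ((integrable_rpow_neg_one_add_norm_sq (by
    rw [finrank_euclideanSpace_fin]; linarith)).const_mul _).lintegral_lt_top

/-- If `N ≥ 4` and `s ∈ (0,1)`, or `N = 3` and `s ∈ (1/2, 1)`, then the
Gagliardo `s`-seminorm of the Aubin–Talenti profile is finite. -/
theorem gagliardo_seminorm_talenti_finite (N : ℕ) (s : ℝ)
    (h : (4 ≤ N ∧ 0 < s ∧ s < 1) ∨ (N = 3 ∧ 1 / 2 < s ∧ s < 1)) :
    ∫⁻ x : EuclideanSpace ℝ (Fin N), ∫⁻ y : EuclideanSpace ℝ (Fin N),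
        ENNReal.ofReal
          (|talentiProfile N x - talentiProfile N y| ^ 2 / ‖x - y‖ ^ ((N : ℝ) + 2 * s))
      < ∞ := by
  obtain ⟨hN, hs0, hs1, hNs⟩ : 3 ≤ N ∧ 0 < s ∧ s < 1 ∧ 4 < (N : ℝ) + 2 * s := by
    rcases h with ⟨hN, hs0, hs1⟩ | ⟨rfl, hs0, hs1⟩
    · have : (4 : ℝ) ≤ N := by exact_mod_cast hN
      exact ⟨by omega, hs0, hs1, by linarith⟩
    · exact ⟨le_rfl, by linarith, hs1, by push_cast; linarith⟩
  have hmeas : Measurable (Function.uncurry fun x y : EuclideanSpace ℝ (Fin N) =>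
      ENNReal.ofReal (talentiMajorant N s x y)) :=
    (talentiMajorant_measurable N s).ennreal_ofReal
  have hfin := lintegral_talentiMajorant_lt_top (by omega : 1 ≤ N) hs0 hs1 hNs
  calc _ ≤ ∫⁻ x : EuclideanSpace ℝ (Fin N), ∫⁻ y : EuclideanSpace ℝ (Fin N),
        (ENNReal.ofReal (talentiMajorant N s x y) + ENNReal.ofReal (talentiMajorant N s y x)) := by
        refine lintegral_mono fun x => lintegral_mono fun y => ?_
        rcases le_total ‖x‖ ‖y‖ with hxy | hxy
        · exact (ENNReal.ofReal_le_ofReal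
            (gagliardo_quotient_talenti_le (by omega) s hxy)).trans le_self_add
        · rw [abs_sub_comm, norm_sub_rev]
          exact (ENNReal.ofReal_le_ofReal
            (gagliardo_quotient_talenti_le (by omega) s hxy)).trans le_add_self
    _ = (∫⁻ x, ∫⁻ y, ENNReal.ofReal (talentiMajorant N s x y))
        + ∫⁻ x, ∫⁻ y, ENNReal.ofReal (talentiMajorant N s y x) := by
        rw [← lintegral_add_left (show Measurable fun x : EuclideanSpace ℝ (Fin N) =>
          ∫⁻ y, ENNReal.ofReal (talentiMajorant N s x y) from hmeas.lintegral_prod_right')]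
        exact lintegral_congr fun x => lintegral_add_left (hmeas.comp measurable_prodMk_left) _
    _ < ∞ := by
        rw [lintegral_lintegral_swap (f := fun x y => ENNReal.ofReal (talentiMajorant N s y x))
          (hmeas.comp measurable_swap).aemeasurable]
        exact ENNReal.add_lt_top.2 ⟨hfin, hfin⟩
end

section
/- Let N ≥ 3, 2* = 2N/(N−2), let Ω̃ ⊂ ℝ^N be measurable with finite Lebesgue measure, let p₂ < r₂ < 2* < r₁ < p₁ be exponents in [1,∞), let σ ≥ 1, and let C₁, M > 0. Suppose u : Ω̃ → ℝ is measurable with ‖u‖_{L^{2*}(Ω̃)} ≤ M and ‖u‖_{p₁,p₂,σ} ≤ C₁ (auxiliary norm with respect to Lebesgue measure on Ω̃). Then ‖u‖_{r₁,r₂,σ} ≤ C₂, where C₂ depends only on N, p₁, p₂, r₁, r₂, the measure of Ω̃, M and C₁ (and not on σ). -/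
open MeasureTheory ENNReal Real

/-- The auxiliary norm `‖u‖_{p₁,p₂,σ}` of Devillanova–Solimini type:
the infimum of all `α > 0` such that `|u| ≤ u₁ + u₂` a.e. with
`‖u₁‖_{p₁} ≤ α` and `‖u₂‖_{p₂} ≤ α σ^(N/2* - N/p₂)` (with `inf ∅ = ∞`),
where `2* = 2N/(N-2)`. -/
noncomputable def auxNorm {X : Type*} [MeasurableSpace X] (μ : Measure X)
    (N : ℕ) (p₁ p₂ σ : ℝ) (u : X → ℝ) : ℝ≥0∞ :=
  sInf {A : ℝ≥0∞ | ∃ a : ℝ, 0 < a ∧ A = ENNReal.ofReal a ∧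
    ∃ u₁ u₂ : X → ℝ, Measurable u₁ ∧ Measurable u₂ ∧
      (∀ x, 0 ≤ u₁ x) ∧ (∀ x, 0 ≤ u₂ x) ∧
      (∀ᵐ x ∂μ, |u x| ≤ u₁ x + u₂ x) ∧
      eLpNorm u₁ (ENNReal.ofReal p₁) μ ≤ ENNReal.ofReal a ∧
      eLpNorm u₂ (ENNReal.ofReal p₂) μ ≤
        ENNReal.ofReal
          (a * σ ^ ((N : ℝ) / (2 * N / ((N : ℝ) - 2)) - (N : ℝ) / p₂))}

/-- Lyapunov's inequality: log-convexity of the `L^p` norms in the reciprocal exponent. -/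
theorem eLpNorm_le_rpow_mul_rpow {X E : Type*} [MeasurableSpace X] {μ : Measure X}
    [NormedAddCommGroup E] {f : X → E} (hf : AEStronglyMeasurable f μ) {p q r θ : ℝ}
    (hp : 0 < p) (hq : 0 < q) (hr : 0 < r) (hθ₀ : 0 ≤ θ) (hθ₁ : θ ≤ 1)
    (h : 1 / r = θ / p + (1 - θ) / q) :
    eLpNorm f (ENNReal.ofReal r) μ ≤
      eLpNorm f (ENNReal.ofReal p) μ ^ θ * eLpNorm f (ENNReal.ofReal q) μ ^ (1 - θ) := by
  have key (s : ℝ) (hs : 0 < s) :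
      eLpNorm f (ENNReal.ofReal s) μ = (∫⁻ x, ‖f x‖ₑ ^ s ∂μ) ^ (1 / s) := by
    rw [eLpNorm_eq_lintegral_rpow_enorm_toReal (by simpa using hs) ENNReal.ofReal_ne_top,
      ENNReal.toReal_ofReal hs.le]
  have hθ : 0 ≤ 1 - θ := sub_nonneg.2 hθ₁
  have hsum : θ * r / p + (1 - θ) * r / q = 1 := by
    calc θ * r / p + (1 - θ) * r / q = r * (θ / p + (1 - θ) / q) := by ring
      _ = 1 := by rw [← h]; field_simp
  have holder := ENNReal.lintegral_mul_norm_pow_le (μ := μ)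
    (hf.enorm.pow_const p) (hf.enorm.pow_const q)
    (show 0 ≤ θ * r / p by positivity) (show 0 ≤ (1 - θ) * r / q by positivity) hsum
  rw [key r hr, key p hp, key q hq]
  calc (∫⁻ x, ‖f x‖ₑ ^ r ∂μ) ^ (1 / r)
      = (∫⁻ x, (‖f x‖ₑ ^ p) ^ (θ * r / p) * (‖f x‖ₑ ^ q) ^ ((1 - θ) * r / q) ∂μ) ^ (1 / r) := by
        congr 2 with x
        rw [← ENNReal.rpow_mul, ← ENNReal.rpow_mul,
          ← ENNReal.rpow_add_of_nonneg _ _ (by positivity) (by positivity)]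
        congr 1
        field_simp
        ring
    _ ≤ ((∫⁻ x, ‖f x‖ₑ ^ p ∂μ) ^ (θ * r / p) *
          (∫⁻ x, ‖f x‖ₑ ^ q ∂μ) ^ ((1 - θ) * r / q)) ^ (1 / r) := by gcongr
    _ = _ := by
        rw [ENNReal.mul_rpow_of_nonneg _ _ (by positivity), ← ENNReal.rpow_mul,
          ← ENNReal.rpow_mul, ← ENNReal.rpow_mul, ← ENNReal.rpow_mul]
        congr 2 <;> field_simp


/-- Interpolation property of the auxiliary norm: a uniform bound in
`‖·‖_{p₁,p₂,σ}` together with a uniform `L^{2*}` bound on a finite-measure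
set yields a uniform bound in `‖·‖_{r₁,r₂,σ}` for any intermediate window
`p₂ < r₂ < 2* < r₁ < p₁`, with a constant independent of `σ ≥ 1`. -/
theorem auxNorm_interpolation (N : ℕ) (hN : 3 ≤ N) (p₁ p₂ r₁ r₂ : ℝ)
    (hp₂ : 1 ≤ p₂) (hp₂r₂ : p₂ < r₂) (hr₂ : r₂ < 2 * N / ((N : ℝ) - 2))
    (hr₁ : 2 * N / ((N : ℝ) - 2) < r₁) (hr₁p₁ : r₁ < p₁)
    (Ω : Set (EuclideanSpace ℝ (Fin N))) (hΩmeas : MeasurableSet Ω)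
    (hΩfin : MeasureTheory.volume Ω < ⊤)
    (M C₁ : ℝ) (hM : 0 < M) (hC₁ : 0 < C₁) :
    ∃ C₂ : ℝ, 0 < C₂ ∧
      ∀ σ : ℝ, 1 ≤ σ →
        ∀ u : EuclideanSpace ℝ (Fin N) → ℝ, Measurable u →
          eLpNorm u (ENNReal.ofReal (2 * N / ((N : ℝ) - 2)))
              (MeasureTheory.volume.restrict Ω) ≤ ENNReal.ofReal M →
          auxNorm (MeasureTheory.volume.restrict Ω) N p₁ p₂ σ u ≤
              ENNReal.ofReal C₁ →
          auxNorm (MeasureTheory.volume.restrict Ω) N r₁ r₂ σ u ≤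
            ENNReal.ofReal C₂ := by
  have hN' : (3 : ℝ) ≤ N := by exact_mod_cast hN
  set q : ℝ := 2 * N / ((N : ℝ) - 2)
  have hp : 0 < p₂ := by linarith
  have hr : 0 < r₂ := by linarith
  have hq : 0 < q := by linarith
  have hpq : 0 < 1 / p₂ - 1 / q :=
    sub_pos.2 (one_div_lt_one_div_of_lt hp (hp₂r₂.trans hr₂))
  have hrq : 0 < 1 / r₂ - 1 / q := sub_pos.2 (one_div_lt_one_div_of_lt hr hr₂)
  have hrp : 1 / r₂ < 1 / p₂ := one_div_lt_one_div_of_lt hp hp₂r₂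
  obtain ⟨θ, hθ⟩ : ∃ θ, θ = (1 / r₂ - 1 / q) / (1 / p₂ - 1 / q) := ⟨_, rfl⟩
  have hθ₀ : 0 ≤ θ := hθ ▸ by positivity
  have hθ₁ : θ ≤ 1 := hθ ▸ (div_le_one hpq).2 (by linarith)
  have hθmul : θ * (1 / p₂ - 1 / q) = 1 / r₂ - 1 / q := by
    rw [hθ, div_mul_cancel₀ _ hpq.ne']
  have hexp : θ * ((N : ℝ) / q - N / p₂) = N / q - N / r₂ := by
    linear_combination (-(N : ℝ)) * hθmul
  set μ := (volume : Measure (EuclideanSpace ℝ (Fin N))).restrict Ω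
  have hμ : μ Set.univ = volume Ω := by simp [μ]
  obtain ⟨V, hV⟩ : ∃ V, V = (volume Ω).toReal ^ (1 / r₁ - 1 / p₁) := ⟨_, rfl⟩
  have hV₀ : 0 ≤ V := hV ▸ by positivity
  have hs : 0 ≤ 1 / r₁ - 1 / p₁ :=
    sub_nonneg.2 (one_div_le_one_div_of_le (by linarith) hr₁p₁.le)
  have hVvol : μ Set.univ ^ (1 / r₁ - 1 / p₁) = ENNReal.ofReal V := by
    rw [hμ, hV, ← ENNReal.ofReal_rpow_of_nonneg ENNReal.toReal_nonneg hs,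
      ENNReal.ofReal_toReal hΩfin.ne]
  refine ⟨(C₁ + 1) * V + (C₁ + 1) ^ θ * M ^ (1 - θ), by positivity, ?_⟩
  intro σ hσ u hu huM hC
  have hσ₀ : 0 < σ := by linarith
  have hlt := hC.trans_lt
    ((ENNReal.ofReal_lt_ofReal_iff (by positivity)).2 (lt_add_one C₁))
  obtain ⟨_, ⟨a, ha, rfl, u₁, u₂, hu₁, hu₂, hu₁₀, hu₂₀, hsum, h₁, h₂⟩, haC⟩ := sInf_lt_iff.1 hlt
  have haC : a ≤ C₁ + 1 := ((ENNReal.ofReal_lt_ofReal_iff (by positivity)).1 haC).le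
  refine sInf_le ⟨_, by positivity, rfl, u₁, fun x => min (u₂ x) |u x|, hu₁,
    hu₂.min hu.norm, hu₁₀, fun x => le_min (hu₂₀ x) (abs_nonneg _), ?_, ?_, ?_⟩
  · filter_upwards [hsum] with x hx
    rcases le_total (u₂ x) |u x| with h | h
    · simpa [h] using hx
    · simpa [h] using hu₁₀ x
  · calc eLpNorm u₁ (ENNReal.ofReal r₁) μ
        ≤ eLpNorm u₁ (ENNReal.ofReal p₁) μ * ENNReal.ofReal V := by
          rw [← hVvol]
          simpa [ENNReal.toReal_ofReal (by linarith : 0 ≤ r₁),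
            ENNReal.toReal_ofReal (by linarith : 0 ≤ p₁)] using
            eLpNorm_le_eLpNorm_mul_rpow_measure_univ (μ := μ)
              (ENNReal.ofReal_le_ofReal hr₁p₁.le) hu₁.aestronglyMeasurable
      _ ≤ ENNReal.ofReal (C₁ + 1) * ENNReal.ofReal V := by
          gcongr
          exact h₁.trans (ENNReal.ofReal_le_ofReal haC)
      _ = ENNReal.ofReal ((C₁ + 1) * V) := (ENNReal.ofReal_mul (by positivity)).symm
      _ ≤ _ := ENNReal.ofReal_le_ofReal (le_add_of_nonneg_right (by positivity))
  · have hv : AEStronglyMeasurable (fun x => min (u₂ x) |u x|) μ :=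
      (hu₂.min hu.norm).aestronglyMeasurable
    have hv₀ (x) : 0 ≤ min (u₂ x) |u x| := le_min (hu₂₀ x) (abs_nonneg _)
    have hvp : eLpNorm (fun x => min (u₂ x) |u x|) (ENNReal.ofReal p₂) μ ≤
        ENNReal.ofReal ((C₁ + 1) * σ ^ ((N : ℝ) / q - N / p₂)) := by
      refine (eLpNorm_mono_real fun x => ?_).trans
        (h₂.trans (ENNReal.ofReal_le_ofReal (by gcongr)))
      rw [Real.norm_of_nonneg (hv₀ x)]
      exact min_le_left _ _
    have hvq : eLpNorm (fun x => min (u₂ x) |u x|) (ENNReal.ofReal q) μ ≤ ENNReal.ofReal M := by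
      refine (eLpNorm_mono fun x => ?_).trans huM
      rw [Real.norm_of_nonneg (hv₀ x)]
      exact min_le_right _ _
    calc eLpNorm (fun x => min (u₂ x) |u x|) (ENNReal.ofReal r₂) μ
        ≤ ENNReal.ofReal ((C₁ + 1) * σ ^ ((N : ℝ) / q - N / p₂)) ^ θ *
            ENNReal.ofReal M ^ (1 - θ) := by
          refine (eLpNorm_le_rpow_mul_rpow hv hp hq hr hθ₀ hθ₁ ?_).trans ?_
          · linear_combination -hθmul
          · gcongr
      _ = ENNReal.ofReal ((C₁ + 1) ^ θ * M ^ (1 - θ) * σ ^ ((N : ℝ) / q - N / r₂)) := by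
          rw [ENNReal.ofReal_rpow_of_pos (by positivity), ENNReal.ofReal_rpow_of_pos hM,
            ← ENNReal.ofReal_mul (by positivity), Real.mul_rpow (by positivity) (by positivity),
            ← Real.rpow_mul hσ₀.le, mul_comm _ θ, hexp]
          congr 1
          ring
      _ ≤ _ := by
          refine ENNReal.ofReal_le_ofReal (mul_le_mul_of_nonneg_right ?_ (by positivity))
          exact le_add_of_nonneg_left (by positivity)
end
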